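/- Suppose the equation of state f satisfies (f1) and (f2), K is a bounded axisymmetric domain satisfying the no-trapping condition, Φ_K = Bρ_K with ρ_K ∈ L^q(K), q > 3, nonnegative and axisymmetric, and Ω ≥ 1 is a constant. Let ρ : ℝ³∖K → [0,∞) be a bounded continuous function with ∫_{ℝ³∖K} ρ = M > 0 satisfying, for some constant λ, the equilibrium relation A'(ρ) − Bρ − ½Ω²r² − Φ_K = λ wherever ρ > 0. Then d := sup{√(x₁²+x₂²) : x ∈ supp ρ} is finite, and λ ≤ −½Ω²d². -/

import Mathlib

open MeasureTheory Filter Set Topology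

noncomputable section

abbrev R3 : Type := EuclideanSpace ℝ (Fin 3)

def rot (θ : ℝ) (x : R3) : R3 :=
  (EuclideanSpace.equiv (Fin 3) ℝ).symm
    ![Real.cos θ * x 0 - Real.sin θ * x 1,
      Real.sin θ * x 0 + Real.cos θ * x 1,
      x 2]

def AxisymmetricFun (g : R3 → ℝ) : Prop := ∀ (θ : ℝ) (x : R3), g (rot θ x) = g x

def AxisymmetricSet (K : Set R3) : Prop := ∀ (θ : ℝ) (x : R3), x ∈ K → rot θ x ∈ K

def rcyl (x : R3) : ℝ := Real.sqrt (x 0 ^ 2 + x 1 ^ 2)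

def Bpot (K : Set R3) (ρ : R3 → ℝ) (x : R3) : ℝ := ∫ y in Kᶜ, ρ y / ‖x - y‖

def Afun (f : ℝ → ℝ) (s : ℝ) : ℝ := s * ∫ t in (0:ℝ)..s, f t / t ^ 2

def F1 (f : ℝ → ℝ) : Prop :=
  (∀ s, 0 < s → 0 ≤ f s) ∧ ContinuousOn f (Ioi 0) ∧ StrictMonoOn f (Ioi 0)

def F2 (f : ℝ → ℝ) : Prop :=
  Tendsto (fun s => f s / s ^ ((4:ℝ)/3)) (nhdsWithin 0 (Ioi 0)) (nhds 0) ∧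
  Tendsto (fun s => f s / s ^ ((4:ℝ)/3)) atTop atTop

def PhiCond (Φ : R3 → ℝ) : Prop :=
  ContDiff ℝ 1 Φ ∧ (∀ x, 0 < Φ x) ∧ AxisymmetricFun Φ ∧
  Tendsto Φ (cocompact R3) (nhds 0) ∧
  ∃ z₀ > 0, ∀ x y : R3, x 0 = y 0 → x 1 = y 1 →
    z₀ < |x 2| → |x 2| ≤ |y 2| → 0 ≤ x 2 * y 2 → Φ y ≤ Φ x

def SolvesEP (K : Set R3) (f : ℝ → ℝ) (J Φ : R3 → ℝ) (ρ : R3 → ℝ) : Prop :=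
  ∀ x ∈ Kᶜ, 0 < ρ x →
    DifferentiableAt ℝ ρ x ∧
    DifferentiableAt ℝ (fun y => f (ρ y)) x ∧
    DifferentiableAt ℝ (fun y => Bpot K ρ y + J y + Φ y) x ∧
    fderiv ℝ (fun y => f (ρ y)) x = ρ x • fderiv ℝ (fun y => Bpot K ρ y + J y + Φ y) x

def IsRotatingSolution (K : Set R3) (f : ℝ → ℝ) (J Φ : R3 → ℝ) (M : ℝ) (ρ : R3 → ℝ) : Prop :=
  ContinuousOn ρ Kᶜ ∧ (∀ x, 0 ≤ ρ x) ∧ HasCompactSupport ρ ∧ AxisymmetricFun ρ ∧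
  SolvesEP K f J Φ ρ ∧ (∫ x in Kᶜ, ρ x) = M

def Jprof (Ω : ℝ → ℝ) (x : R3) : ℝ := ∫ s in (0:ℝ)..(rcyl x), s * Ω s ^ 2

def Jconst (Ω : ℝ) (x : R3) : ℝ := (1/2) * Ω ^ 2 * rcyl x ^ 2

def OmegaCond (Ω : ℝ → ℝ) : Prop :=
  (∀ s, 0 ≤ s → 0 ≤ s * Ω s ^ 2) ∧ ContinuousOn (fun s => s * Ω s ^ 2) (Ici 0) ∧
  IntegrableOn (fun s => s * Ω s ^ 2) (Ici 0)

/-- The horizontal (cylindrical radial) part of a point. -/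
def horiz (x : R3) : R3 :=
  (EuclideanSpace.equiv (Fin 3) ℝ).symm ![x 0, x 1, 0]

/-- The "no trapping" condition on the core `K`. -/
def NoTrapping (K : Set R3) : Prop :=
  ∀ x ∈ Kᶜ, ∀ t : ℝ, 0 ≤ t → x + t • horiz x ∈ Kᶜ

/-- `A'(s) = ∫₀^s f(t)/t² dt + f(s)/s`. -/
def Aprime (f : ℝ → ℝ) (s : ℝ) : ℝ := (∫ t in (0:ℝ)..s, f t / t ^ 2) + f s / s

/-- Newtonian potential of the core density `ρ_K`, integrated over `K`. -/
def BpotK (K : Set R3) (ρK : R3 → ℝ) (x : R3) : ℝ := ∫ y in K, ρK y / ‖x - y‖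

theorem exists_le_mul_rpow_of_F1_of_F2 {f : ℝ → ℝ} (hf1 : F1 f) (hf2 : F2 f) {C : ℝ} (hC : 0 < C) :
    ∃ E : ℝ, 0 < E ∧ ∀ t, 0 < t → t ≤ C → f t ≤ E * t ^ ((4 : ℝ) / 3) := by
  have h := hf2.1.eventually (eventually_le_nhds (zero_lt_one' ℝ))
  obtain ⟨δ, hδ, hsub⟩ := mem_nhdsGT_iff_exists_Ioo_subset.1 h
  have hδ : 0 < δ := hδ
  have hδp : 0 < δ ^ ((4 : ℝ) / 3) := Real.rpow_pos_of_pos hδ _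
  refine ⟨max 1 (f C / δ ^ ((4 : ℝ) / 3)), lt_max_of_lt_left one_pos, fun t ht htC => ?_⟩
  have htp : 0 < t ^ ((4 : ℝ) / 3) := Real.rpow_pos_of_pos ht _
  rcases lt_or_ge t δ with htδ | htδ
  · have h1 : f t / t ^ ((4 : ℝ) / 3) ≤ 1 := hsub ⟨ht, htδ⟩
    rw [← div_le_iff₀ htp]
    exact h1.trans (le_max_left _ _)
  · have h1 : f t ≤ f C := hf1.2.2.monotoneOn ht hC htC
    have h2 : δ ^ ((4 : ℝ) / 3) ≤ t ^ ((4 : ℝ) / 3) :=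
      Real.rpow_le_rpow hδ.le htδ (by norm_num)
    have h3 : 0 ≤ f C / δ ^ ((4 : ℝ) / 3) := div_nonneg (hf1.1 C hC) hδp.le
    calc f t ≤ f C / δ ^ ((4 : ℝ) / 3) * δ ^ ((4 : ℝ) / 3) := by
          rwa [div_mul_cancel₀ _ hδp.ne']
      _ ≤ f C / δ ^ ((4 : ℝ) / 3) * t ^ ((4 : ℝ) / 3) := by gcongr
      _ ≤ _ := by gcongr; exact le_max_right _ _

theorem exists_Aprime_le_mul_rpow {f : ℝ → ℝ} (hf1 : F1 f) (hf2 : F2 f) {C : ℝ} (hC : 0 < C) :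
    ∃ E : ℝ, 0 < E ∧ ∀ s, 0 < s → s ≤ C → Aprime f s ≤ E * s ^ ((1 : ℝ) / 3) := by
  obtain ⟨E, hE, hfE⟩ := exists_le_mul_rpow_of_F1_of_F2 hf1 hf2 hC
  refine ⟨4 * E, by positivity, fun s hs hsC => ?_⟩
  have hint : IntervalIntegrable (fun t : ℝ => E * t ^ (-(2 : ℝ) / 3)) volume 0 s :=
    (intervalIntegral.intervalIntegrable_rpow' (by norm_num)).const_mul E
  have hval : ∫ t in (0 : ℝ)..s, E * t ^ (-(2 : ℝ) / 3) = 3 * E * s ^ ((1 : ℝ) / 3) := by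
    rw [intervalIntegral.integral_const_mul, integral_rpow (Or.inl (by norm_num))]
    norm_num
    ring
  have hle : ∫ t in (0 : ℝ)..s, f t / t ^ 2 ≤ 3 * E * s ^ ((1 : ℝ) / 3) := by
    rw [← hval, intervalIntegral.integral_of_le hs.le, intervalIntegral.integral_of_le hs.le]
    refine integral_mono_of_nonneg ?_ hint.1 ?_
    · filter_upwards [ae_restrict_mem measurableSet_Ioc] with t ht
      exact div_nonneg (hf1.1 t ht.1) (sq_nonneg t)
    · filter_upwards [ae_restrict_mem measurableSet_Ioc] with t ht
      have ht0 : 0 < t := ht.1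
      rw [div_le_iff₀ (by positivity), mul_assoc, ← Real.rpow_natCast t 2, ← Real.rpow_add ht0,
        show -(2 : ℝ) / 3 + (2 : ℕ) = 4 / 3 by norm_num]
      exact hfE t ht0 (ht.2.trans hsC)
  have hdiv : f s / s ≤ E * s ^ ((1 : ℝ) / 3) := by
    rw [div_le_iff₀ hs, mul_assoc, ← Real.rpow_add_one hs.ne', show (1 : ℝ) / 3 + 1 = 4 / 3 by norm_num]
    exact hfE s hs hsC
  unfold Aprime
  linarith

theorem rcyl_add_smul_horiz (x : R3) {t : ℝ} (ht : 0 ≤ t) :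
    rcyl (x + t • horiz x) = (1 + t) * rcyl x := by
  have h : (x + t • horiz x) 0 ^ 2 + (x + t • horiz x) 1 ^ 2
      = (1 + t) ^ 2 * (x 0 ^ 2 + x 1 ^ 2) := by
    simp [horiz]
    ring
  unfold rcyl
  rw [h, Real.sqrt_mul (sq_nonneg _), Real.sqrt_sq (by linarith)]

theorem ae_rcyl_pos : ∀ᵐ x : R3, 0 < rcyl x := by
  let p : R3 →ₗ[ℝ] ℝ := (EuclideanSpace.proj (0 : Fin 3) : R3 →L[ℝ] ℝ).toLinearMap
  have hp : LinearMap.ker p ≠ ⊤ := by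
    intro h
    have h1 : EuclideanSpace.single (0 : Fin 3) (1 : ℝ) ∈ LinearMap.ker p := h ▸ Submodule.mem_top
    simp [p] at h1
  have hnull := Measure.addHaar_submodule (volume : Measure R3) _ hp
  filter_upwards [measure_eq_zero_iff_ae_notMem.1 hnull] with x hx
  have hx0 : x 0 ≠ 0 := fun h => hx (by simpa [p] using h)
  exact Real.sqrt_pos.2 (by positivity)

theorem pos_on_Ici_of_gap {g : ℝ → ℝ} (hg : ContinuousOn g (Ici 0)) (hg0 : 0 < g 0) {m : ℝ}
    (hm : 0 < m) (hgap : ∀ t, 0 ≤ t → 0 < g t → m ≤ g t) {t : ℝ} (ht : 0 ≤ t) : 0 < g t := by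
  by_contra! hneg
  have hivt := intermediate_value_Icc' ht (hg.mono Icc_subset_Ici_self)
  obtain ⟨u, hu, hgu⟩ := hivt (show m / 2 ∈ Icc (g t) (g 0) from
    ⟨by linarith, by linarith [hgap 0 le_rfl hg0]⟩)
  have := hgap u hu.1 (by linarith)
  linarith

/-- **Lemmas 6.6 and 6.7.** For a bounded continuous solution `ρ` of the equilibrium
relation with constant angular velocity `Ω ≥ 1`, the cylindrical radius of the
support of `ρ` is bounded, with supremum `d`, and the constant `λ` satisfies
`λ ≤ -½Ω²d²`. -/
theorem support_radius_bounded_and_lambda_bound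
    (f : ℝ → ℝ) (hf1 : F1 f) (hf2 : F2 f)
    (K : Set R3) (hKo : IsOpen K) (hKb : Bornology.IsBounded K) (hKa : AxisymmetricSet K)
    (hKnt : NoTrapping K)
    (q : ℝ) (hq : q > 3)
    (ρK : R3 → ℝ) (hρK0 : ∀ x, 0 ≤ ρK x) (hρKa : AxisymmetricFun ρK)
    (hρKsupp : ∀ x ∉ K, ρK x = 0) (hρKq : Integrable (fun x => ρK x ^ q))
    (Ω : ℝ) (hΩ : 1 ≤ Ω)
    (M : ℝ) (hM : 0 < M)
    (ρ : R3 → ℝ) (lam : ℝ)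
    (hρc : ContinuousOn ρ Kᶜ) (hρ0 : ∀ x, 0 ≤ ρ x) (hρb : ∃ Cb : ℝ, ∀ x, ρ x ≤ Cb)
    (hρM : (∫ x in Kᶜ, ρ x) = M)
    (heq : ∀ x ∈ Kᶜ, 0 < ρ x →
      Aprime f (ρ x) - Bpot K ρ x - Jconst Ω x - BpotK K ρK x = lam) :
    BddAbove (rcyl '' (Kᶜ ∩ Function.support ρ)) ∧
    lam ≤ -(1/2) * Ω ^ 2 * (sSup (rcyl '' (Kᶜ ∩ Function.support ρ))) ^ 2 := by
  obtain ⟨Cb, hCb⟩ := hρb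
  obtain ⟨E, hE, hA⟩ := exists_Aprime_le_mul_rpow hf1 hf2
    (C := max Cb 1) (lt_max_of_lt_right one_pos)
  have hbound : ∀ x ∈ Kᶜ, 0 < ρ x →
      lam + 1 / 2 * Ω ^ 2 * rcyl x ^ 2 ≤ E * ρ x ^ ((1 : ℝ) / 3) := by
    intro x hx hpos
    have h1 := heq x hx hpos
    have h2 := hA (ρ x) hpos ((hCb x).trans (le_max_left _ _))
    have h3 : 0 ≤ Bpot K ρ x :=
      integral_nonneg fun y => div_nonneg (hρ0 y) (norm_nonneg _)
    have h4 : 0 ≤ BpotK K ρK x :=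
      integral_nonneg fun y => div_nonneg (hρK0 y) (norm_nonneg _)
    unfold Jconst at h1
    linarith
  have hr0 : ∀ x, 0 ≤ rcyl x := fun x => Real.sqrt_nonneg _
  have hΩ2 : 1 ≤ Ω ^ 2 := one_le_pow₀ hΩ
  have hbdd : BddAbove (rcyl '' (Kᶜ ∩ Function.support ρ)) := by
    refine ⟨Real.sqrt (2 * (E * (max Cb 1) ^ ((1 : ℝ) / 3) - lam)), ?_⟩
    rintro _ ⟨x, ⟨hx, hxs⟩, rfl⟩
    have hpos : 0 < ρ x := (hρ0 x).lt_of_ne' hxs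
    have h1 := hbound x hx hpos
    have h2 : ρ x ^ ((1 : ℝ) / 3) ≤ (max Cb 1) ^ ((1 : ℝ) / 3) :=
      Real.rpow_le_rpow hpos.le ((hCb x).trans (le_max_left _ _)) (by norm_num)
    have h3 := mul_le_mul_of_nonneg_left h2 hE.le
    refine Real.le_sqrt_of_sq_le ?_
    nlinarith [mul_le_mul_of_nonneg_right hΩ2 (sq_nonneg (rcyl x))]
  have hoff : ∀ x ∈ Kᶜ, 0 < ρ x → 0 < rcyl x → lam + 1 / 2 * Ω ^ 2 * rcyl x ^ 2 ≤ 0 := by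
    intro x hx hpos hr
    by_contra! hc
    set c := lam + 1 / 2 * Ω ^ 2 * rcyl x ^ 2 with hcdef
    have hray : ∀ t : ℝ, 0 ≤ t → 0 < ρ (x + t • horiz x) := by
      intro t ht
      refine pos_on_Ici_of_gap (g := fun t => ρ (x + t • horiz x)) (m := (c / E) ^ 3)
        (hρc.comp (by fun_prop) fun t ht => hKnt x hx t ht) (by simpa using hpos)
        (by positivity) (fun u hu hgu => ?_) ht
      have h1 := hbound _ (hKnt x hx u hu) hgu
      have h2 : rcyl x ^ 2 ≤ rcyl (x + u • horiz x) ^ 2 := by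
        rw [rcyl_add_smul_horiz x hu]
        exact pow_le_pow_left₀ hr.le (by nlinarith) 2
      have h3 := mul_le_mul_of_nonneg_left h2 (by positivity : 0 ≤ 1 / 2 * Ω ^ 2)
      have h4 : c / E ≤ ρ (x + u • horiz x) ^ ((1 : ℝ) / 3) := by
        rw [div_le_iff₀ hE]
        linarith
      calc (c / E) ^ 3 ≤ (ρ (x + u • horiz x) ^ ((1 : ℝ) / 3)) ^ 3 :=
            pow_le_pow_left₀ (by positivity) h4 3
        _ = ρ (x + u • horiz x) := by
            rw [← Real.rpow_natCast, ← Real.rpow_mul hgu.le]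
            norm_num
    obtain ⟨R, hR⟩ := hbdd
    have ht : 0 ≤ |R| / rcyl x := by positivity
    have h1 := hR ⟨_, ⟨hKnt x hx _ ht, (hray _ ht).ne'⟩, rfl⟩
    rw [rcyl_add_smul_horiz x ht, add_mul, div_mul_cancel₀ _ hr.ne'] at h1
    linarith [le_abs_self R]
  obtain ⟨x₀, hx₀, hpos₀, hr₀⟩ : ∃ x ∈ Kᶜ, 0 < ρ x ∧ 0 < rcyl x := by
    by_contra! hcon
    refine hM.ne' (hρM.symm.trans (integral_eq_zero_of_ae ?_))
    filter_upwards [ae_restrict_mem hKo.measurableSet.compl, ae_restrict_of_ae ae_rcyl_pos]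
      with x hx hr
    by_contra hne
    exact absurd (hcon x hx ((hρ0 x).lt_of_ne' hne)) hr.not_ge
  have hlam : lam ≤ 0 := by
    nlinarith [hoff x₀ hx₀ hpos₀ hr₀, mul_nonneg (sq_nonneg Ω) (sq_nonneg (rcyl x₀))]
  refine ⟨hbdd, ?_⟩
  have hsup : sSup (rcyl '' (Kᶜ ∩ Function.support ρ)) ≤ Real.sqrt (-lam * 2 / Ω ^ 2) := by
    refine csSup_le ⟨_, x₀, ⟨hx₀, hpos₀.ne'⟩, rfl⟩ ?_
    rintro _ ⟨x, ⟨hx, hxs⟩, rfl⟩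
    rcases (hr0 x).eq_or_lt with h | h
    · rw [← h]
      exact Real.sqrt_nonneg _
    · refine Real.le_sqrt_of_sq_le ?_
      rw [le_div_iff₀ (by positivity)]
      linarith [hoff x hx ((hρ0 x).lt_of_ne' hxs) h]
  have hsup0 : 0 ≤ sSup (rcyl '' (Kᶜ ∩ Function.support ρ)) :=
    Real.sSup_nonneg (by rintro _ ⟨x, _, rfl⟩; exact hr0 x)
  have hsq := (Real.le_sqrt hsup0 (div_nonneg (by linarith) (by positivity))).1 hsup
  rw [le_div_iff₀ (by positivity)] at hsq
  linarith
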